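/- arXiv:math/0610464 — 4 statements merged into one kernel-verified Lean document; each statement's English description precedes it below -/
import Mathlib

section
/- Alternating-sum formula for the eigenspace Hilbert series of a complete intersection quotient: in ℂ[[t]], H^χ(t) = Σ_{p=0}^{m} (−1)^p Σ_{γ∈Γ_p} t^{d_γ} · 𝓗^{χ χ_γ^{-1}}(t), where for γ = (i_1,…,i_p) ∈ Γ_p one sets d_γ = Σ_{j=1}^{p} d_{i_j} and χ_γ = ∏_{j=1}^{p} χ_{i_j} (with d_γ = 0 and χ_γ = 1 for the empty tuple). -/
open MvPolynomial

/-- The `j`-th diagonal entry of an element of a subgroup of `GL (Fin n) ℂ`. -/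
noncomputable def diagEntry {n : ℕ} (G : Subgroup (GL (Fin n) ℂ)) (g : G) (j : Fin n) : ℂ :=
  ((g : GL (Fin n) ℂ) : Matrix (Fin n) (Fin n) ℂ) j j

/-- The subgroup `G ≤ GL(n,ℂ)` consists of diagonal matrices. -/
def IsDiagonalSubgroup {n : ℕ} (G : Subgroup (GL (Fin n) ℂ)) : Prop :=
  ∀ g : G, ∀ i j : Fin n, i ≠ j → ((g : GL (Fin n) ℂ) : Matrix (Fin n) (Fin n) ℂ) i j = 0

/-- The linear action of `g ∈ G` on `S = ℂ[z_1,…,z_n]` given by substituting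
`z_j ↦ g_j z_j`, where `g_j` is the `j`-th diagonal entry of `g`. -/
noncomputable def diagAct {n : ℕ} (G : Subgroup (GL (Fin n) ℂ)) (g : G) :
    MvPolynomial (Fin n) ℂ →ₐ[ℂ] MvPolynomial (Fin n) ℂ :=
  aeval fun j => C (diagEntry G g j) * X j

/-- The `χ`-eigenspace `S^χ = {f ∈ S : g·f = χ(g) f for all g ∈ G}`. -/
noncomputable def eigSpace {n : ℕ} (G : Subgroup (GL (Fin n) ℂ)) (χ : G →* ℂˣ) :
    Submodule ℂ (MvPolynomial (Fin n) ℂ) where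
  carrier := {f | ∀ g : G, diagAct G g f = (χ g : ℂ) • f}
  add_mem' := by
    intro a b ha hb g
    rw [map_add, ha g, hb g, smul_add]
  zero_mem' := by
    intro g
    rw [map_zero, smul_zero]
  smul_mem' := by
    intro c a ha g
    rw [map_smul, ha g, smul_comm]

/-- The Hilbert series `𝓗^χ(t) = Σ_{i≥0} (dim_ℂ S_i^χ) t^i ∈ ℂ[[t]]` of the
`χ`-eigenspace, where `S_i^χ = S^χ ∩ S_i` and `S_i` is the `i`-th graded piece
for the grading `deg z_j = w_j`. -/
noncomputable def eigHilbert {n : ℕ} (w : Fin n → ℕ) (G : Subgroup (GL (Fin n) ℂ))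
    (χ : G →* ℂˣ) : PowerSeries ℂ :=
  PowerSeries.mk fun i =>
    (Module.finrank ℂ ↥(weightedHomogeneousSubmodule ℂ w i ⊓ eigSpace G χ) : ℂ)

/-- `Γ_p`: the set of strictly increasing `p`-tuples with entries among `1,…,m`. -/
abbrev IndexTuple (m p : ℕ) : Type := {γ : Fin p → Fin m // StrictMono γ}

noncomputable instance (m p : ℕ) : Fintype (IndexTuple m p) := Fintype.ofFinite _

open PowerSeries (coeff_mk)

section LinearAlgebra

theorem Submodule.finrank_map_add_finrank_inf_ker {K V W : Type*} [Field K] [AddCommGroup V]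
    [Module K V] [AddCommGroup W] [Module K W] (φ : V →ₗ[K] W) (p : Submodule K V)
    [FiniteDimensional K p] :
    Module.finrank K (p.map φ) + Module.finrank K ↥(p ⊓ LinearMap.ker φ) =
      Module.finrank K p := by
  have h := LinearMap.finrank_range_add_finrank_ker (φ.domRestrict p)
  rw [LinearMap.range_domRestrict, LinearMap.ker_domRestrict] at h
  rw [← h, ← Submodule.map_comap_subtype, Submodule.finrank_map_subtype_eq]

end LinearAlgebra

section GradedQuotient

variable {K S M : Type*} [Field K] [CommRing S] [Algebra K S]
  (𝒜 : M → Submodule K S)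

/-- The Hilbert function of the quotient of a graded algebra by an ideal. -/
noncomputable def quotientHilbert (J : Ideal S) (e : M) : ℕ :=
  Module.finrank K ((𝒜 e).map (Ideal.Quotient.mkₐ K J).toLinearMap)

theorem quotientHilbert_add_finrank_inf (J : Ideal S) (e : M) [FiniteDimensional K (𝒜 e)] :
    quotientHilbert 𝒜 J e + Module.finrank K ↥(𝒜 e ⊓ J.restrictScalars K) =
      Module.finrank K (𝒜 e) := by
  have hker : LinearMap.ker (Ideal.Quotient.mkₐ K J).toLinearMap = J.restrictScalars K := by
    ext x
    simp [Ideal.Quotient.eq_zero_iff_mem]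
  rw [← hker]
  exact Submodule.finrank_map_add_finrank_inf_ker _ _

variable [AddCommGroup M] [DecidableEq M] [GradedAlgebra 𝒜]

theorem inf_sup_span_singleton_eq {J : Ideal S} (hJ : J.IsHomogeneous 𝒜) {f : S} {e₀ : M}
    (hf : f ∈ 𝒜 e₀) (e : M) :
    𝒜 e ⊓ (J ⊔ Ideal.span {f}).restrictScalars K =
      (𝒜 e ⊓ J.restrictScalars K) ⊔ (𝒜 (e - e₀)).map (LinearMap.mulLeft K f) := by
  apply le_antisymm
  · rintro x ⟨hx, hxJ⟩
    obtain ⟨a, ha, b, hb, rfl⟩ := Submodule.mem_sup.mp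
      (show x ∈ J ⊔ Ideal.span {f} from hxJ)
    obtain ⟨c, rfl⟩ := Ideal.mem_span_singleton'.mp hb
    have key : a + c * f = (DirectSum.decompose 𝒜 a e : S) +
        f * (DirectSum.decompose 𝒜 c (e - e₀) : S) := by
      have h1 := DirectSum.decompose_of_mem_same 𝒜 hx
      have h2 := DirectSum.coe_decompose_mul_add_of_left_mem 𝒜 (i := e₀) (j := e - e₀)
        (a := f) (b := c) hf
      rw [add_sub_cancel] at h2
      rw [← h1, DirectSum.decompose_add, DirectSum.add_apply, Submodule.coe_add, mul_comm c f, h2]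
    rw [key]
    exact Submodule.add_mem_sup ⟨SetLike.coe_mem _, hJ e ha⟩
      (Submodule.mem_map_of_mem (f := LinearMap.mulLeft K f) (SetLike.coe_mem _))
  · refine sup_le (inf_le_inf_left _ fun x hx => Ideal.mem_sup_left hx) ?_
    rintro _ ⟨x, hx, rfl⟩
    refine ⟨?_, Ideal.mem_sup_right (Ideal.mul_mem_right _ _ (Ideal.mem_span_singleton_self f))⟩
    have := SetLike.mul_mem_graded hf hx
    rwa [add_sub_cancel] at this

theorem quotientHilbert_sup_span_singleton [∀ e, FiniteDimensional K (𝒜 e)] {J : Ideal S}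
    (hJ : J.IsHomogeneous 𝒜) {f : S} {e₀ : M} (hf : f ∈ 𝒜 e₀)
    (hreg : ∀ h, f * h ∈ J → h ∈ J) (e : M) :
    quotientHilbert 𝒜 (J ⊔ Ideal.span {f}) e + quotientHilbert 𝒜 J (e - e₀) =
      quotientHilbert 𝒜 J e := by
  have hinf : (𝒜 e ⊓ J.restrictScalars K) ⊓ (𝒜 (e - e₀)).map (LinearMap.mulLeft K f) =
      (𝒜 (e - e₀) ⊓ J.restrictScalars K).map (LinearMap.mulLeft K f) := by
    apply le_antisymm
    · rintro _ ⟨⟨-, hxJ⟩, y, hy, rfl⟩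
      exact ⟨y, ⟨hy, hreg y hxJ⟩, rfl⟩
    · rintro _ ⟨y, ⟨hy, hyJ⟩, rfl⟩
      refine ⟨⟨?_, J.mul_mem_left f hyJ⟩, y, hy, rfl⟩
      have := SetLike.mul_mem_graded hf hy
      rwa [add_sub_cancel] at this
  have hker : 𝒜 (e - e₀) ⊓ J.restrictScalars K ⊓ LinearMap.ker (LinearMap.mulLeft K f) =
      𝒜 (e - e₀) ⊓ LinearMap.ker (LinearMap.mulLeft K f) := by
    rw [inf_assoc]
    refine congrArg _ (inf_eq_right.mpr fun y hy => hreg y ?_)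
    rw [LinearMap.mem_ker, LinearMap.mulLeft_apply] at hy
    exact hy ▸ J.zero_mem
  have : FiniteDimensional K ↥(𝒜 (e - e₀) ⊓ J.restrictScalars K) :=
    Submodule.finiteDimensional_inf_left _ _
  have : FiniteDimensional K ↥(𝒜 e ⊓ J.restrictScalars K) :=
    Submodule.finiteDimensional_inf_left _ _
  have h1 := quotientHilbert_add_finrank_inf 𝒜 (J ⊔ Ideal.span {f}) e
  have h2 := quotientHilbert_add_finrank_inf 𝒜 J e
  have h3 := quotientHilbert_add_finrank_inf 𝒜 J (e - e₀)
  have h4 := Submodule.finrank_sup_add_finrank_inf_eq (𝒜 e ⊓ J.restrictScalars K)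
    ((𝒜 (e - e₀)).map (LinearMap.mulLeft K f))
  have h5 := Submodule.finrank_map_add_finrank_inf_ker (LinearMap.mulLeft K f) (𝒜 (e - e₀))
  have h6 := Submodule.finrank_map_add_finrank_inf_ker (LinearMap.mulLeft K f)
    (𝒜 (e - e₀) ⊓ J.restrictScalars K)
  rw [inf_sup_span_singleton_eq 𝒜 hJ hf] at h1
  rw [hinf] at h4
  rw [hker] at h6
  omega

end GradedQuotient

section RegularSequence

theorem RingTheory.Sequence.IsWeaklyRegular.mem_of_mul_mem {R : Type*} [CommRing R] {m : ℕ}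
    {f : Fin m → R} (h : RingTheory.Sequence.IsWeaklyRegular R (List.ofFn f)) (k : Fin m)
    {x : R} (hx : f k * x ∈ Ideal.span (f '' {j | j < k})) :
    x ∈ Ideal.span (f '' {j | j < k}) := by
  have hk := h.regular_mod_prev k (by simp)
  have hlist : Ideal.ofList ((List.ofFn f).take k) • (⊤ : Submodule R R) =
      Ideal.span (f '' {j | j < k}) := by
    rw [Ideal.smul_eq_mul, Ideal.mul_top, Ideal.ofList]
    congr 1
    ext r
    simp only [List.mem_take_iff_getElem, Set.mem_ofPred_eq, Set.mem_image, List.getElem_ofFn,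
      List.length_ofFn, lt_min_iff]
    constructor
    · rintro ⟨i, hi, rfl⟩
      exact ⟨⟨i, hi.2⟩, hi.1, rfl⟩
    · rintro ⟨j, hj, rfl⟩
      exact ⟨j, ⟨hj, j.2⟩, rfl⟩
  rw [hlist, List.getElem_ofFn] at hk
  rw [← Submodule.Quotient.mk_eq_zero]
  exact hk.right_eq_zero_of_smul (by
    rw [← Submodule.Quotient.mk_smul, Submodule.Quotient.mk_eq_zero]
    exact hx)

end RegularSequence

section DiagonalAction

variable {n : ℕ} (G : Subgroup (GL (Fin n) ℂ))

theorem coeff_diagAct (g : G) (f : MvPolynomial (Fin n) ℂ) (a : Fin n →₀ ℕ) :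
    coeff a (diagAct G g f) = (∏ j, diagEntry G g j ^ a j) * coeff a f := by
  induction f using MvPolynomial.induction_on' with
  | monomial b c =>
    have h : diagAct G g (monomial b c) =
        monomial b ((∏ j, diagEntry G g j ^ b j) * c) := by
      rw [diagAct, aeval_monomial, Finsupp.prod_fintype _ _ (by simp)]
      simp_rw [mul_pow, Finset.prod_mul_distrib, ← map_pow, ← map_prod]
      rw [algebraMap_eq, ← mul_assoc, ← map_mul, monomial_eq,
        Finsupp.prod_fintype _ _ (by simp), mul_comm c]
    rw [h, coeff_monomial, coeff_monomial]
    split_ifs with hab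
    · rw [hab]
    · rw [mul_zero]
  | add p q hp hq => rw [map_add, coeff_add, coeff_add, hp, hq, mul_add]

variable {G} (hG : IsDiagonalSubgroup G)

/-- The character of a diagonal group given by the `j`-th diagonal entry. -/
noncomputable def diagChar (j : Fin n) : G →* ℂˣ :=
  MonoidHom.toHomUnits
    { toFun := fun g => diagEntry G g j
      map_one' := by simp [diagEntry]
      map_mul' := fun g h => by
        simp only [diagEntry, Subgroup.coe_mul, Units.val_mul, Matrix.mul_apply]
        exact Finset.sum_eq_single j (fun k _ hk => by rw [hG g j k hk.symm, zero_mul]) (by simp) }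

theorem coe_diagChar (j : Fin n) (g : G) : (diagChar hG j g : ℂ) = diagEntry G g j := rfl

/-- The weights refining the grading `deg z_j = w_j` by the characters of `G`. Integral rather
than natural weights make the grading monoid a group. -/
noncomputable def diagWeight (w : Fin n → ℕ) (j : Fin n) : ℤ × Additive (G →* ℂˣ) :=
  (w j, Additive.ofMul (diagChar hG j))

theorem weight_diagWeight_fst (w : Fin n → ℕ) (a : Fin n →₀ ℕ) :
    (Finsupp.weight (diagWeight hG w) a).1 = (Finsupp.weight w a : ℤ) := by
  have h : (Finsupp.weight (diagWeight hG w) a).1 = ∑ j, a j • (w j : ℤ) := by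
    rw [Finsupp.weight_eq_sum, Prod.fst_sum]
    rfl
  rw [h, Finsupp.weight_eq_sum]
  simp

theorem weight_diagWeight_snd (w : Fin n → ℕ) (a : Fin n →₀ ℕ) (g : G) :
    ((Finsupp.weight (diagWeight hG w) a).2.toMul g : ℂ) = ∏ j, diagEntry G g j ^ a j := by
  have h : (Finsupp.weight (diagWeight hG w) a).2.toMul = ∏ j, diagChar hG j ^ a j := by
    rw [Finsupp.weight_eq_sum, Prod.snd_sum, toMul_sum]
    rfl
  rw [h, MonoidHom.finsetProd_apply, Units.coe_prod]
  rfl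

theorem weightedHomogeneousSubmodule_diagWeight (w : Fin n → ℕ) (i : ℕ) (χ : G →* ℂˣ) :
    weightedHomogeneousSubmodule ℂ (diagWeight hG w) ((i : ℤ), Additive.ofMul χ) =
      weightedHomogeneousSubmodule ℂ w i ⊓ eigSpace G χ := by
  ext f
  have heig : f ∈ eigSpace G χ ↔ ∀ a, coeff a f ≠ 0 → ∀ g : G,
      ∏ j, diagEntry G g j ^ a j = (χ g : ℂ) := by
    change (∀ g : G, diagAct G g f = (χ g : ℂ) • f) ↔ _
    simp only [MvPolynomial.ext_iff, coeff_diagAct, coeff_smul, smul_eq_mul]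
    refine ⟨fun h a ha g => mul_right_cancel₀ ha (h g a), fun h g a => ?_⟩
    by_cases ha : coeff a f = 0
    · rw [ha, mul_zero, mul_zero]
    · rw [h a ha g]
  rw [Submodule.mem_inf, heig, mem_weightedHomogeneousSubmodule, mem_weightedHomogeneousSubmodule]
  have hweight (a : Fin n →₀ ℕ) :
      Finsupp.weight (diagWeight hG w) a = ((i : ℤ), Additive.ofMul χ) ↔
        Finsupp.weight w a = i ∧ ∀ g : G, ∏ j, diagEntry G g j ^ a j = (χ g : ℂ) := by
    simp_rw [Prod.ext_iff, weight_diagWeight_fst, Nat.cast_inj, ← weight_diagWeight_snd hG w]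
    refine and_congr_right fun _ => ⟨fun h g => by rw [h]; rfl, fun h => ?_⟩
    exact Additive.toMul.injective (MonoidHom.ext fun g => Units.ext (h g))
  simp only [IsWeightedHomogeneous, hweight]
  exact ⟨fun h => ⟨fun a ha => (h ha).1, fun a ha => (h ha).2⟩,
    fun h a ha => ⟨h.1 ha, h.2 a ha⟩⟩

theorem weightedHomogeneousSubmodule_diagWeight_of_neg (w : Fin n → ℕ)
    {e : ℤ × Additive (G →* ℂˣ)} (he : e.1 < 0) :
    weightedHomogeneousSubmodule ℂ (diagWeight hG w) e = ⊥ := by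
  refine (Submodule.eq_bot_iff _).mpr fun f hf => MvPolynomial.ext _ _ fun a => ?_
  by_contra ha
  have h := weight_diagWeight_fst hG w a
  rw [hf ha] at h
  omega

theorem finiteDimensional_weightedHomogeneousSubmodule_diagWeight {w : Fin n → ℕ}
    (hw : ∀ j, 0 < w j) (e : ℤ × Additive (G →* ℂˣ)) :
    FiniteDimensional ℂ (weightedHomogeneousSubmodule ℂ (diagWeight hG w) e) := by
  obtain ⟨i, χ⟩ := e
  rcases lt_or_ge i 0 with hi | hi
  · rw [weightedHomogeneousSubmodule_diagWeight_of_neg hG w hi]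
    infer_instance
  · lift i to ℕ using hi
    have : FiniteDimensional ℂ (weightedHomogeneousSubmodule ℂ w i) :=
      Module.Finite.iff_fg.mpr
        (weightedHomogeneousSubmodule_fg ℂ w (fun j => (hw j).ne') i)
    have h := weightedHomogeneousSubmodule_diagWeight hG w i χ.toMul
    rw [ofMul_toMul] at h
    rw [h]
    exact Submodule.finiteDimensional_inf_left _ _

/-- The Hilbert series of the `χ`-eigenspace of `S/J`. -/
noncomputable def quotientEigHilbert (w : Fin n → ℕ) (J : Ideal (MvPolynomial (Fin n) ℂ))
    (χ : G →* ℂˣ) : PowerSeries ℂ :=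
  PowerSeries.mk fun i =>
    (quotientHilbert (weightedHomogeneousSubmodule ℂ (diagWeight hG w)) J
      ((i : ℤ), Additive.ofMul χ) : ℂ)

theorem quotientEigHilbert_bot {w : Fin n → ℕ} (hw : ∀ j, 0 < w j) (χ : G →* ℂˣ) :
    quotientEigHilbert hG w ⊥ χ = eigHilbert w G χ := by
  ext i
  have := finiteDimensional_weightedHomogeneousSubmodule_diagWeight hG hw
  have h := quotientHilbert_add_finrank_inf
    (weightedHomogeneousSubmodule ℂ (diagWeight hG w)) ⊥ ((i : ℤ), Additive.ofMul χ)
  rw [Submodule.restrictScalars_bot, inf_bot_eq, finrank_bot, add_zero,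
    weightedHomogeneousSubmodule_diagWeight] at h
  rw [quotientEigHilbert, eigHilbert, coeff_mk, coeff_mk, h]

open Classical in
attribute [local instance] MvPolynomial.weightedGradedAlgebra in
theorem quotientEigHilbert_sup_span_singleton {w : Fin n → ℕ} (hw : ∀ j, 0 < w j)
    {J : Ideal (MvPolynomial (Fin n) ℂ)}
    (hJ : J.IsHomogeneous (weightedHomogeneousSubmodule ℂ (diagWeight hG w)))
    {f : MvPolynomial (Fin n) ℂ} {d : ℕ} {ψ : G →* ℂˣ}
    (hf : f ∈ weightedHomogeneousSubmodule ℂ w d ⊓ eigSpace G ψ)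
    (hreg : ∀ h, f * h ∈ J → h ∈ J) (χ : G →* ℂˣ) :
    quotientEigHilbert hG w (J ⊔ Ideal.span {f}) χ =
      quotientEigHilbert hG w J χ -
        (PowerSeries.X : PowerSeries ℂ) ^ d * quotientEigHilbert hG w J (χ * ψ⁻¹) := by
  rw [eq_sub_iff_add_eq]
  ext i
  have := finiteDimensional_weightedHomogeneousSubmodule_diagWeight hG hw
  rw [← weightedHomogeneousSubmodule_diagWeight hG] at hf
  have h := quotientHilbert_sup_span_singleton
    (weightedHomogeneousSubmodule ℂ (diagWeight hG w)) hJ hf hreg ((i : ℤ), Additive.ofMul χ)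
  rw [map_add, PowerSeries.coeff_X_pow_mul']
  simp only [quotientEigHilbert, coeff_mk]
  rw [← h, Nat.cast_add]
  congr 1
  split_ifs with hdi
  · have hdeg : ((i : ℤ), Additive.ofMul χ) - ((d : ℤ), Additive.ofMul ψ) =
        (((i - d : ℕ) : ℤ), Additive.ofMul (χ * ψ⁻¹)) :=
      Prod.ext (Nat.cast_sub hdi).symm (congrArg Additive.ofMul (div_eq_mul_inv χ ψ))
    rw [hdeg]
  · rw [quotientHilbert, weightedHomogeneousSubmodule_diagWeight_of_neg hG w, Submodule.map_bot,
      finrank_bot, Nat.cast_zero]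
    simp only [Prod.fst_sub]
    omega

open Classical in
attribute [local instance] MvPolynomial.weightedGradedAlgebra in
theorem quotientEigHilbert_span_eq_sum_powerset {m : ℕ} {w : Fin n → ℕ} (hw : ∀ j, 0 < w j)
    {f : Fin m → MvPolynomial (Fin n) ℂ} {d : Fin m → ℕ} {χs : Fin m → (G →* ℂˣ)}
    (hf : ∀ i, f i ∈ weightedHomogeneousSubmodule ℂ w (d i) ⊓ eigSpace G (χs i))
    (hreg : RingTheory.Sequence.IsWeaklyRegular (MvPolynomial (Fin n) ℂ) (List.ofFn f))
    {k : ℕ} (hk : k ≤ m) (χ : G →* ℂˣ) :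
    quotientEigHilbert hG w (Ideal.span (f '' {j | (j : ℕ) < k})) χ =
      ∑ s ∈ (Finset.univ.filter fun j : Fin m => (j : ℕ) < k).powerset,
        (-1 : PowerSeries ℂ) ^ s.card * ((PowerSeries.X : PowerSeries ℂ) ^ (∑ j ∈ s, d j) *
          eigHilbert w G (χ * (∏ j ∈ s, χs j)⁻¹)) := by
  induction k generalizing χ with
  | zero =>
    have hχ : χ * 1⁻¹ = χ := (congrArg (χ * ·) inv_one).trans (mul_one χ)
    simp [quotientEigHilbert_bot hG hw, hχ]
  | succ k ih =>
    set l : Fin m := ⟨k, hk⟩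
    have hset : {j : Fin m | (j : ℕ) < k + 1} = {j : Fin m | (j : ℕ) < k} ∪ {l} := by
      ext j
      simp [l, Fin.ext_iff, Nat.le_iff_lt_or_eq, or_comm]
    have hfilter : (Finset.univ.filter fun j : Fin m => (j : ℕ) < k + 1) =
        insert l (Finset.univ.filter fun j : Fin m => (j : ℕ) < k) := by
      ext j
      simp [l, Fin.ext_iff, Nat.le_iff_lt_or_eq, or_comm]
    have hl : l ∉ Finset.univ.filter fun j : Fin m => (j : ℕ) < k := by simp [l]
    have hJ : (Ideal.span (f '' {j | (j : ℕ) < k})).IsHomogeneous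
        (weightedHomogeneousSubmodule ℂ (diagWeight hG w)) := by
      refine Ideal.homogeneous_span _ _ ?_
      rintro _ ⟨j, -, rfl⟩
      exact ⟨_, (weightedHomogeneousSubmodule_diagWeight hG w (d j) (χs j)).symm ▸ hf j⟩
    rw [hset, Set.image_union, Set.image_singleton, Ideal.span_union,
      quotientEigHilbert_sup_span_singleton hG hw hJ (hf l)
        (fun _ => hreg.mem_of_mul_mem l), ih (Nat.le_of_succ_le hk), ih (Nat.le_of_succ_le hk),
      hfilter, Finset.sum_powerset_insert hl, sub_eq_add_neg, Finset.mul_sum,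
      ← Finset.sum_neg_distrib]
    congr 1
    refine Finset.sum_congr rfl fun s hs => ?_
    have hls : l ∉ s := fun h => hl (Finset.mem_powerset.mp hs h)
    have hχ : χ * (χs l * ∏ j ∈ s, χs j)⁻¹ = χ * (χs l)⁻¹ * (∏ j ∈ s, χs j)⁻¹ :=
      (congrArg (χ * ·) (mul_inv _ _)).trans (mul_assoc _ _ _).symm
    rw [Finset.card_insert_of_notMem hls, Finset.sum_insert hls, Finset.prod_insert hls,
      hχ, pow_succ, pow_add]
    ring

end DiagonalAction

section Averaging

variable {n : ℕ} {G : Subgroup (GL (Fin n) ℂ)}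

theorem diagAct_mul (hG : IsDiagonalSubgroup G) (g h : G) (f : MvPolynomial (Fin n) ℂ) :
    diagAct G g (diagAct G h f) = diagAct G (g * h) f := by
  ext a
  simp only [coeff_diagAct, ← coe_diagChar hG, map_mul, Units.val_mul, mul_pow,
    Finset.prod_mul_distrib, mul_assoc]

/-- Averaging over the group lifts a homogeneous eigenvector of the quotient. -/
theorem exists_mem_inf_eigSpace [Fintype G] (hG : IsDiagonalSubgroup G) {w : Fin n → ℕ} {i : ℕ}
    {J : Ideal (MvPolynomial (Fin n) ℂ)} {h : MvPolynomial (Fin n) ℂ} (χ : G →* ℂˣ)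
    (hh : h ∈ weightedHomogeneousSubmodule ℂ w i)
    (hχ : ∀ g : G, Ideal.Quotient.mk J (diagAct G g h) = (χ g : ℂ) • Ideal.Quotient.mk J h) :
    ∃ h' ∈ weightedHomogeneousSubmodule ℂ w i ⊓ eigSpace G χ,
      Ideal.Quotient.mk J h' = Ideal.Quotient.mk J h := by
  have hcard : (Fintype.card G : ℂ) ≠ 0 := Nat.cast_ne_zero.mpr Fintype.card_ne_zero
  refine ⟨(Fintype.card G : ℂ)⁻¹ • ∑ g : G, ((χ g)⁻¹ : ℂ) • diagAct G g h, ⟨?_, ?_⟩, ?_⟩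
  · refine Submodule.smul_mem _ _ (Submodule.sum_mem _ fun g _ => Submodule.smul_mem _ _ ?_)
    intro a ha
    rw [coeff_diagAct] at ha
    exact hh (right_ne_zero_of_mul ha)
  · intro g
    rw [map_smul, map_sum, smul_comm]
    congr 1
    rw [Finset.smul_sum]
    refine Fintype.sum_equiv (Equiv.mulLeft g) _ _ fun x => ?_
    rw [map_smul, diagAct_mul hG, smul_smul, Equiv.coe_mulLeft, map_mul, Units.val_mul, mul_inv,
      mul_inv_cancel_left₀ (Units.ne_zero _)]
  · change Ideal.Quotient.mkₐ ℂ J _ = Ideal.Quotient.mk J h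
    simp only [map_smul, map_sum, Ideal.Quotient.mkₐ_eq_mk, hχ, smul_smul,
      inv_mul_cancel₀ (Units.ne_zero _), one_smul, Finset.sum_const, Finset.card_univ]
    rw [← Nat.cast_smul_eq_nsmul ℂ, smul_smul, inv_mul_cancel₀ hcard, one_smul]

end Averaging

theorem sum_indexTuple {m p : ℕ} {A : Type*} [AddCommMonoid A] (F : Finset (Fin m) → A) :
    ∑ γ : IndexTuple m p, F (Finset.univ.image γ.1) =
      ∑ s ∈ Finset.univ.powersetCard p, F s := by
  refine Finset.sum_bij (fun γ _ => Finset.univ.image γ.1) (fun γ _ => ?_) (fun γ _ δ _ h => ?_)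
    (fun s hs => ?_) (fun _ _ => rfl)
  · simp [Finset.mem_powersetCard, Finset.card_image_of_injective _ γ.2.injective]
  · refine Subtype.ext ((γ.2.range_inj δ.2).mp ?_)
    simpa using congrArg (fun s : Finset (Fin m) => (s : Set (Fin m))) h
  · have hc := (Finset.mem_powersetCard.mp hs).2
    exact ⟨⟨s.orderEmbOfFin hc, (s.orderEmbOfFin hc).strictMono⟩, Finset.mem_univ _,
      Finset.image_orderEmbOfFin_univ s hc⟩

/-- **Alternating-sum formula for the eigenspace Hilbert series of a complete
intersection quotient**: with `G ≤ GL(n,ℂ)` a finite diagonal subgroup acting on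
`S = ℂ[z_1,…,z_n]` (grading `deg z_j = w_j > 0`), `f_1,…,f_m` a regular sequence of
homogeneous eigen-elements (`deg f_i = d_i`, character `χ_i`), `I = (f_1,…,f_m)`, the
Hilbert series of the `χ`-eigenspace of `S/I` satisfies, in `ℂ[[t]]`,
`H^χ(t) = Σ_{p=0}^m (-1)^p Σ_{γ ∈ Γ_p} t^{d_γ} 𝓗^{χ χ_γ^{-1}}(t)`,
with `d_γ = Σ_j d_{i_j}` and `χ_γ = Π_j χ_{i_j}`. -/
theorem hilbert_series_alternating_sum {n m : ℕ} (w : Fin n → ℕ) (hw : ∀ j, 0 < w j)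
    (G : Subgroup (GL (Fin n) ℂ)) [Fintype G] (hG : IsDiagonalSubgroup G)
    (f : Fin m → MvPolynomial (Fin n) ℂ) (d : Fin m → ℕ)
    (hreg : RingTheory.Sequence.IsRegular (MvPolynomial (Fin n) ℂ) (List.ofFn f))
    (hhom : ∀ i, (f i).IsWeightedHomogeneous w (d i))
    (χs : Fin m → (G →* ℂˣ))
    (hf : ∀ i, ∀ g : G, diagAct G g (f i) = (χs i g : ℂ) • f i)
    (I : Ideal (MvPolynomial (Fin n) ℂ)) (hI : I = Ideal.span (Set.range f))
    (χ : G →* ℂˣ)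
    (Q : ℕ → Submodule ℂ (MvPolynomial (Fin n) ℂ ⧸ I))
    (hQ : ∀ (i : ℕ) (x : MvPolynomial (Fin n) ℂ ⧸ I), x ∈ Q i ↔
      ((∃ h ∈ weightedHomogeneousSubmodule ℂ w i, Ideal.Quotient.mk I h = x) ∧
        ∀ g : G, ∀ h : MvPolynomial (Fin n) ℂ, Ideal.Quotient.mk I h = x →
          Ideal.Quotient.mk I (diagAct G g h) = (χ g : ℂ) • x)) :
    (PowerSeries.mk fun i => (Module.finrank ℂ (Q i) : ℂ)) =
      ∑ p ∈ Finset.range (m + 1), (-1 : PowerSeries ℂ) ^ p *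
        ∑ γ : IndexTuple m p,
          (PowerSeries.X : PowerSeries ℂ) ^ (∑ j : Fin p, d (γ.1 j)) *
            eigHilbert w G (χ * (∏ j : Fin p, χs (γ.1 j))⁻¹) := by
  have hfe (i : Fin m) : f i ∈ weightedHomogeneousSubmodule ℂ w (d i) ⊓ eigSpace G (χs i) :=
    ⟨hhom i, hf i⟩
  have hstable (g : G) {x : MvPolynomial (Fin n) ℂ} (hx : x ∈ I) : diagAct G g x ∈ I := by
    suffices I ≤ I.comap (diagAct G g) from this hx
    conv_lhs => rw [hI]
    rw [Ideal.span_le]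
    rintro _ ⟨j, rfl⟩
    change diagAct G g (f j) ∈ I
    rw [hf j g, smul_eq_C_mul, hI]
    exact Ideal.mul_mem_left _ _ (Ideal.subset_span ⟨j, rfl⟩)
  have hQmap (i : ℕ) : Q i = (weightedHomogeneousSubmodule ℂ w i ⊓ eigSpace G χ).map
      (Ideal.Quotient.mkₐ ℂ I).toLinearMap := by
    ext x
    rw [hQ]
    constructor
    · rintro ⟨⟨h, hh, rfl⟩, hx⟩
      exact exists_mem_inf_eigSpace hG χ hh fun g => hx g h rfl
    · rintro ⟨h, ⟨hh, hχ⟩, rfl⟩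
      refine ⟨⟨h, hh, rfl⟩, fun g h' hh' => ?_⟩
      have hmem := hstable g (Ideal.Quotient.eq.mp hh')
      rw [map_sub] at hmem
      rw [Ideal.Quotient.eq.mpr hmem, hχ g]
      exact map_smul (Ideal.Quotient.mkₐ ℂ I) _ _
  have hlhs : (PowerSeries.mk fun i => (Module.finrank ℂ (Q i) : ℂ)) =
      quotientEigHilbert hG w I χ := by
    ext i
    rw [quotientEigHilbert, coeff_mk, coeff_mk, quotientHilbert,
      weightedHomogeneousSubmodule_diagWeight, hQmap]
  have hspan : I = Ideal.span (f '' {j | (j : ℕ) < m}) := by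
    rw [hI, ← Set.image_univ]
    congr 2
    ext j
    simp
  rw [hlhs, hspan, quotientEigHilbert_span_eq_sum_powerset hG hw hfe hreg.toIsWeaklyRegular le_rfl]
  simp only [Fin.is_lt, Finset.filter_true, Finset.sum_powerset, Finset.card_univ, Fintype.card_fin]
  refine Finset.sum_congr rfl fun p _ => ?_
  rw [← sum_indexTuple, Finset.mul_sum]
  refine Finset.sum_congr rfl fun γ _ => ?_
  rw [Finset.card_image_of_injective _ γ.2.injective, Finset.card_univ, Fintype.card_fin,
    Finset.sum_image γ.2.injective.injOn, Finset.prod_image γ.2.injective.injOn]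
end

section
/- Constant term of partial sums of a generating function with root-of-unity poles: let f : ℕ → ℂ and let p, q, r ∈ ℂ[t] be polynomials with q(0) ≠ 0, deg r < deg q, and Σ_{n≥0} f(n) tⁿ = p(t) + r(t)·q(t)^{-1} as an identity in ℂ[[t]] (q(t)^{-1} being the inverse of q in ℂ[[t]]). Let N be a positive integer with N > deg p such that α^N = 1 for every complex root α of q. Then there exists a polynomial Q ∈ ℂ[x] such that Q(m) = Σ_{n=0}^{mN−1} f(n) for every integer m ≥ 1, and Q(0) = p(1). -/
open PowerSeries in
theorem PowerSeries.coeff_one_sub_X_pow_pow_mul (G : PowerSeries ℂ) (N d n : ℕ) :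
    coeff (n + d * N) ((1 - X ^ N) ^ d * G) =
      (fwdDiff N)^[d] (fun i => coeff i G) n := by
  induction d generalizing n with
  | zero => simp
  | succ d ih =>
    rw [Function.iterate_succ_apply', fwdDiff, ← ih, ← ih, pow_succ', mul_assoc, sub_mul, one_mul,
      map_sub, show n + (d + 1) * N = (n + d * N) + N by ring, coeff_X_pow_mul,
      show n + N + d * N = (n + d * N) + N by ring]

open PowerSeries in
/-- The series of partial sums of `G`, multiplied by `1 - X`, is `X * G`. -/
theorem PowerSeries.one_sub_X_mul_mk_sum_range (G : PowerSeries ℂ) :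
    (1 - X) * mk (fun n => ∑ i ∈ Finset.range n, coeff i G) = X * G := by
  ext n
  cases n with
  | zero => simp
  | succ n =>
    rw [sub_mul, one_mul, map_sub, coeff_succ_X_mul, coeff_succ_X_mul, coeff_mk, coeff_mk,
      Finset.sum_range_succ, add_sub_cancel_left]

/-- A function whose iterated differences with step `N` vanish is polynomial along the
multiples of `N`. -/
theorem exists_polynomial_eval_of_fwdDiff_iter_eq_zero (T : ℕ → ℂ) (N D : ℕ)
    (h : ∀ n, (fwdDiff N)^[D] T n = 0) :
    ∃ Q : Polynomial ℂ, ∀ m : ℕ, Q.eval (m : ℂ) = T (m * N) := by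
  have hk : ∀ k, D ≤ k → (fwdDiff N)^[k] T 0 = 0 := by
    intro k hk
    obtain ⟨e, rfl⟩ := Nat.exists_eq_add_of_le' hk
    rw [Function.iterate_add_apply, show (fwdDiff N)^[D] T = fun _ => 0 from funext h]
    have : ∀ e, (fwdDiff N)^[e] (fun _ : ℕ => (0 : ℂ)) = fun _ => 0 := by
      intro e
      induction e with
      | zero => rfl
      | succ e ih => rw [Function.iterate_succ_apply', ih]; funext; simp [fwdDiff]
    rw [this]
  refine ⟨∑ k ∈ Finset.range D,
    Polynomial.C ((fwdDiff N)^[k] T 0 / k.factorial) * descPochhammer ℂ k, fun m => ?_⟩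
  have hs := shift_eq_sum_fwdDiff_iter N T m 0
  rw [zero_add, smul_eq_mul] at hs
  rw [hs, Polynomial.eval_finsetSum]
  have key : ∀ k, Polynomial.eval (m : ℂ)
      (Polynomial.C ((fwdDiff N)^[k] T 0 / k.factorial) * descPochhammer ℂ k) =
      m.choose k • (fwdDiff N)^[k] T 0 := by
    intro k
    have : (k.factorial : ℂ) ≠ 0 := by exact_mod_cast k.factorial_ne_zero
    rw [Polynomial.eval_mul, Polynomial.eval_C, descPochhammer_eval_eq_descFactorial,
      Nat.descFactorial_eq_factorial_mul_choose, nsmul_eq_mul]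
    push_cast
    field_simp
  rw [Finset.sum_congr rfl fun k _ => key k]
  rcases le_total D (m + 1) with hD | hD
  · refine Finset.sum_subset (Finset.range_mono hD) fun k _ hkD => ?_
    rw [hk k (by simpa using hkD), smul_zero]
  · refine (Finset.sum_subset (Finset.range_mono hD) fun k _ hkm => ?_).symm
    rw [Nat.choose_eq_zero_of_lt (by simpa using hkm), zero_smul]

open Polynomial in
theorem Polynomial.dvd_one_sub_X_pow_pow (q : ℂ[X]) (hq : q ≠ 0) (N : ℕ)
    (hroots : ∀ α : ℂ, q.eval α = 0 → α ^ N = 1) :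
    q ∣ (1 - X ^ N) ^ Multiset.card q.roots := by
  have hlc : IsUnit (C q.leadingCoeff) :=
    isUnit_C.2 (isUnit_iff_ne_zero.2 (leadingCoeff_ne_zero.2 hq))
  rw [(IsAlgClosed.splits q).eq_prod_roots, hlc.mul_left_dvd,
    ← (IsAlgClosed.splits q).eq_prod_roots, ← Multiset.prod_replicate, ← Multiset.map_const']
  refine Multiset.prod_dvd_prod_of_dvd _ _ fun a ha => ?_
  rw [dvd_iff_isRoot, IsRoot.def]
  simp [hroots a (isRoot_of_mem_roots ha)]

open PowerSeries in
/-- If `(1 - X ^ N) ^ d * G` is a polynomial of degree less than `N * d`, then the partial sums of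
the coefficients of `G` over `m * N` terms are polynomial in `m`. -/
theorem PowerSeries.exists_polynomial_eval_eq_sum_range (G : PowerSeries ℂ) (N d : ℕ)
    (s : Polynomial ℂ) (hs : s.degree < (d * N : ℕ))
    (hG : (1 - X ^ N) ^ d * G = (s : PowerSeries ℂ)) :
    ∃ Q : Polynomial ℂ, ∀ m : ℕ,
      Q.eval (m : ℂ) = ∑ n ∈ Finset.range (m * N), coeff n G := by
  refine exists_polynomial_eval_of_fwdDiff_iter_eq_zero
    (fun n => ∑ i ∈ Finset.range n, coeff i G) N (d + 1) fun n => ?_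
  have h := coeff_one_sub_X_pow_pow_mul (mk fun n => ∑ i ∈ Finset.range n, coeff i G) N (d + 1) n
  simp only [coeff_mk] at h
  rw [← h]
  have hgeom : (1 - X ^ N : PowerSeries ℂ) =
      (∑ i ∈ Finset.range N, X ^ i) * (1 - X) := (geom_sum_mul_neg X N).symm
  have hT : (1 - X ^ N) ^ (d + 1) * mk (fun n => ∑ i ∈ Finset.range n, coeff i G) =
      ∑ i ∈ Finset.range N, X ^ (i + 1) * (s : PowerSeries ℂ) := by
    rw [pow_succ]
    nth_rw 2 [hgeom]
    rw [mul_assoc, mul_assoc, one_sub_X_mul_mk_sum_range, ← Finset.sum_mul, ← hG]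
    simp only [pow_succ, ← Finset.sum_mul]
    ring
  rw [hT, map_sum]
  refine Finset.sum_eq_zero fun i hi => ?_
  have hi' : i + 1 ≤ N := Finset.mem_range.1 hi
  obtain ⟨c, rfl⟩ := Nat.exists_eq_add_of_le hi'
  rw [show n + (d + 1) * (i + 1 + c) = (n + c + d * (i + 1 + c)) + (i + 1) by ring,
    coeff_X_pow_mul, Polynomial.coeff_coe]
  refine Polynomial.coeff_eq_zero_of_degree_lt (hs.trans_le ?_)
  exact_mod_cast Nat.le_add_left _ _

/-- **Constant term of partial sums of a generating function with root-of-unity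
poles**: let `f : ℕ → ℂ` and `p, q, r ∈ ℂ[t]` with `q(0) ≠ 0`, `deg r < deg q`, and
`Σ_{n≥0} f(n) tⁿ = p(t) + r(t)·q(t)⁻¹` in `ℂ[[t]]`.  If `N > deg p` is a positive
integer with `α^N = 1` for every root `α` of `q`, then there is a polynomial
`Q ∈ ℂ[x]` with `Q(m) = Σ_{n=0}^{mN-1} f(n)` for every integer `m ≥ 1` and
`Q(0) = p(1)`. -/
theorem constant_term_of_partial_sums (f : ℕ → ℂ) (p q r : Polynomial ℂ)
    (hq0 : q.eval 0 ≠ 0) (hdeg : r.degree < q.degree)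
    (hgen : (PowerSeries.mk f : PowerSeries ℂ) =
      (p : PowerSeries ℂ) + (r : PowerSeries ℂ) * ((q : PowerSeries ℂ))⁻¹)
    (N : ℕ) (hN : 0 < N) (hNp : p.degree < (N : ℕ))
    (hroots : ∀ α : ℂ, q.eval α = 0 → α ^ N = 1) :
    ∃ Q : Polynomial ℂ,
      (∀ m : ℕ, 1 ≤ m → Q.eval (m : ℂ) = ∑ n ∈ Finset.range (m * N), f n) ∧
      Q.eval 0 = p.eval 1 := by
  have hq : q ≠ 0 := by
    rintro rfl
    simp at hq0
  obtain ⟨u, hu⟩ := Polynomial.dvd_one_sub_X_pow_pow q hq N hroots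
  set d := Multiset.card q.roots
  have hqc : PowerSeries.constantCoeff (q : PowerSeries ℂ) ≠ 0 := by
    rwa [Polynomial.constantCoeff_coe, Polynomial.coeff_zero_eq_eval_zero]
  have hXN : (1 - Polynomial.X ^ N : Polynomial ℂ).degree = N := by
    rw [← neg_sub, Polynomial.degree_neg, ← Polynomial.C_1, Polynomial.degree_X_pow_sub_C hN]
  have hXN0 : (1 - Polynomial.X ^ N : Polynomial ℂ) ≠ 0 := by
    intro h
    simp [h] at hXN
  have hu0 : u ≠ 0 := by
    rintro rfl
    rw [mul_zero] at hu
    exact pow_ne_zero _ hXN0 hu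
  have hs : (r * u).degree < (d * N : ℕ) := by
    have h1 : (r * u).degree < (q * u).degree := by
      rw [Polynomial.degree_mul, Polynomial.degree_mul]
      exact WithBot.add_lt_add_right (Polynomial.degree_ne_bot.2 hu0) hdeg
    rwa [← hu, Polynomial.degree_pow, hXN, nsmul_eq_mul, ← Nat.cast_mul] at h1
  have hG : (1 - PowerSeries.X ^ N) ^ d * ((r : PowerSeries ℂ) * (q : PowerSeries ℂ)⁻¹) =
      ((r * u : Polynomial ℂ) : PowerSeries ℂ) := by
    have h := congrArg (fun a : Polynomial ℂ => (a : PowerSeries ℂ)) hu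
    simp only [Polynomial.coe_pow, Polynomial.coe_sub, Polynomial.coe_one, Polynomial.coe_X,
      Polynomial.coe_mul] at h
    rw [h, Polynomial.coe_mul]
    linear_combination (r : PowerSeries ℂ) * u * PowerSeries.mul_inv_cancel _ hqc
  obtain ⟨Q, hQ⟩ := PowerSeries.exists_polynomial_eval_eq_sum_range _ N d _ hs hG
  refine ⟨Polynomial.C (p.eval 1) + Q, fun m hm => ?_, ?_⟩
  · have hf : ∀ n, f n = p.coeff n +
        PowerSeries.coeff n ((r : PowerSeries ℂ) * (q : PowerSeries ℂ)⁻¹) := by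
      intro n
      have h := congrArg (PowerSeries.coeff n) hgen
      rwa [PowerSeries.coeff_mk, map_add, Polynomial.coeff_coe] at h
    have hp : p.natDegree < m * N := by
      refine lt_of_lt_of_le ?_ (Nat.le_mul_of_pos_left N hm)
      by_cases h0 : p = 0
      · simpa [h0] using hN
      · exact (Polynomial.natDegree_lt_iff_degree_lt h0).2 hNp
    rw [Polynomial.eval_add, Polynomial.eval_C, hQ, Polynomial.eval_eq_sum_range' hp,
      ← Finset.sum_add_distrib]
    exact Finset.sum_congr rfl fun n _ => by rw [hf, one_pow, mul_one]
  · have h := hQ 0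
    rw [Nat.cast_zero, zero_mul, Finset.sum_range_zero] at h
    rw [Polynomial.eval_add, Polynomial.eval_C, h, add_zero]
end

section
/- Polynomiality with zero constant term of partial sums: let f : ℕ → ℂ and let q, r ∈ ℂ[t] be polynomials with q(0) ≠ 0, deg r < deg q, and Σ_{n≥0} f(n) tⁿ = r(t)·q(t)^{-1} as an identity in ℂ[[t]]. Let N be a positive integer such that α^N = 1 for every complex root α of q. Then there exists a polynomial P ∈ ℂ[x] such that P(m) = Σ_{n=0}^{mN−1} f(n) for every integer m ≥ 0; in particular P(0) = 0. -/
open Polynomial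

/-- A polynomial over an algebraically closed field divides a power of any polynomial vanishing
at all of its roots. -/
theorem Polynomial.dvd_pow_natDegree_of_roots {K : Type*} [Field K] [IsAlgClosed K]
    {q s : K[X]} (hq : q ≠ 0) (h : ∀ a, q.eval a = 0 → s.eval a = 0) :
    q ∣ s ^ q.natDegree := by
  have hs := IsAlgClosed.splits q
  have hprod : (q.roots.map fun a => X - C a).prod ∣ (q.roots.map fun _ => s).prod :=
    Multiset.prod_dvd_prod_of_dvd _ _ fun a ha =>
      dvd_iff_isRoot.2 (h a (isRoot_of_mem_roots ha))
  rw [Multiset.map_const', Multiset.prod_replicate, ← hs.natDegree_eq_card_roots] at hprod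
  have hlead : IsUnit (C q.leadingCoeff) := isUnit_C.2 (leadingCoeff_ne_zero.2 hq).isUnit
  exact (dvd_of_eq hs.eq_prod_roots).trans (hlead.mul_left_dvd.2 hprod)

/-- Multiplying a generating function by `(1 - X ^ N) ^ d` takes iterated forward differences. -/
theorem PowerSeries.coeff_mk_mul_one_sub_X_pow_pow {R : Type*} [CommRing R] (f : ℕ → R)
    (N d n : ℕ) :
    PowerSeries.coeff (n + N * d) (PowerSeries.mk f * (1 - PowerSeries.X ^ N) ^ d) =
      (fwdDiff N)^[d] f n := by
  induction d generalizing n with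
  | zero => simp
  | succ d ih =>
    rw [Function.iterate_succ_apply', fwdDiff, ← ih, ← ih, pow_succ, ← mul_assoc, mul_sub,
      mul_one, map_sub, show n + N * (d + 1) = n + N * d + N by ring,
      PowerSeries.coeff_mul_X_pow, show n + N * d + N = n + N + N * d by ring]

/-- A function annihilated by a power of the forward difference operator with step `h` is
polynomial along every progression of step `h`. -/
theorem exists_polynomial_of_fwdDiff_iter_eq_zero {K : Type*} [Field K] [CharZero K]
    (g : ℕ → K) (h d y : ℕ) (hg : (fwdDiff h)^[d] g = 0) :
    ∃ P : K[X], ∀ m : ℕ, P.eval (m : K) = g (y + m * h) := by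
  have hk : ∀ k, d ≤ k → (fwdDiff h)^[k] g y = 0 := by
    intro k hk
    obtain ⟨j, rfl⟩ := Nat.exists_eq_add_of_le hk
    rw [add_comm, Function.iterate_add_apply, hg]
    have : (fwdDiff h)^[j] (0 : ℕ → K) = 0 :=
      Function.iterate_fixed (fwdDiff_const h (0 : K)) j
    simp [this]
  refine ⟨∑ k ∈ Finset.range d,
    C ((fwdDiff h)^[k] g y * (k.factorial : K)⁻¹) * descPochhammer K k, fun m => ?_⟩
  have hm := shift_eq_sum_fwdDiff_iter h g m y
  rw [smul_eq_mul] at hm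
  rw [hm, eval_finsetSum]
  have hextend_range : ∑ k ∈ Finset.range (m + 1), m.choose k • (fwdDiff h)^[k] g y =
      ∑ k ∈ Finset.range (max d (m + 1)), m.choose k • (fwdDiff h)^[k] g y := by
    refine Finset.sum_subset (by simp) fun k _ hk => ?_
    rw [Nat.choose_eq_zero_of_lt (by simpa using hk), zero_smul]
  have hextend_order : ∑ k ∈ Finset.range d, m.choose k • (fwdDiff h)^[k] g y =
      ∑ k ∈ Finset.range (max d (m + 1)), m.choose k • (fwdDiff h)^[k] g y := by
    refine Finset.sum_subset (by simp) fun k _ hkd => ?_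
    rw [hk k (by simpa using hkd), smul_zero]
  rw [hextend_range, ← hextend_order]
  refine Finset.sum_congr rfl fun k _ => ?_
  have hf : (k.factorial : K) ≠ 0 := by exact_mod_cast k.factorial_ne_zero
  rw [eval_mul, eval_C, descPochhammer_eval_eq_descFactorial,
    Nat.descFactorial_eq_factorial_mul_choose, nsmul_eq_mul]
  push_cast
  field_simp

/-- If the forward difference of step `h` and order `d` of `f` vanishes, then the one of order
`d + 1` of the partial sums of `f` vanishes. -/
theorem fwdDiff_iter_succ_sum_range_eq_zero {R : Type*} [AddCommGroup R] (f : ℕ → R) (h d : ℕ)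
    (hf : (fwdDiff h)^[d] f = 0) :
    (fwdDiff h)^[d + 1] (fun y => ∑ n ∈ Finset.range y, f n) = 0 := by
  have h1 : fwdDiff h (fun y => ∑ n ∈ Finset.range y, f n) =
      ∑ j ∈ Finset.range h, fun y => f (y + j) := by
    ext y
    simp [fwdDiff, Finset.sum_range_add]
  rw [Function.iterate_succ_apply, h1, fwdDiff_iter_finsetSum]
  refine Finset.sum_eq_zero fun j _ => ?_
  ext y
  rw [fwdDiff_iter_comp_add, hf]
  rfl

theorem partial_sums_polynomial_of_generating_function (f : ℕ → ℂ) (q r : Polynomial ℂ)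
    (hq0 : q.eval 0 ≠ 0) (hdeg : r.degree < q.degree)
    (hgen : (PowerSeries.mk f : PowerSeries ℂ) =
      (r : PowerSeries ℂ) * ((q : PowerSeries ℂ))⁻¹)
    (N : ℕ) (hN : 0 < N)
    (hroots : ∀ α : ℂ, q.eval α = 0 → α ^ N = 1) :
    ∃ P : Polynomial ℂ,
      (∀ m : ℕ, P.eval (m : ℂ) = ∑ n ∈ Finset.range (m * N), f n) ∧
      P.eval 0 = 0 := by
  have hq : q ≠ 0 := by rintro rfl; simp at hq0
  obtain ⟨s, hs⟩ : q ∣ (1 - X ^ N) ^ q.natDegree :=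
    dvd_pow_natDegree_of_roots hq fun a ha => by simp [hroots a ha]
  have hdeg_pow : ((1 - X ^ N : ℂ[X]) ^ q.natDegree).natDegree = N * q.natDegree := by
    have h1 : (1 - X ^ N : ℂ[X]) = -(X ^ N - C 1) := by simp
    rw [natDegree_pow, h1, natDegree_neg, natDegree_X_pow_sub_C, mul_comm]
  have hpow : (1 - X ^ N : ℂ[X]) ^ q.natDegree ≠ 0 := by
    refine pow_ne_zero _ fun h0 => ?_
    simpa [hN.ne'] using congrArg (eval 0) h0
  have hs0 : s ≠ 0 := by rintro rfl; simp [hpow] at hs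
  have hrs : (r * s).degree < (N * q.natDegree : ℕ) := by
    rw [← hdeg_pow, ← degree_eq_natDegree hpow, hs, degree_mul, degree_mul]
    exact WithBot.add_lt_add_right (degree_ne_bot.2 hs0) hdeg
  have hmul : PowerSeries.mk f * (1 - PowerSeries.X ^ N) ^ q.natDegree =
      ((r * s : ℂ[X]) : PowerSeries ℂ) := by
    have hcast : (1 - PowerSeries.X ^ N : PowerSeries ℂ) ^ q.natDegree = q * s := by
      rw [← Polynomial.coe_mul, ← hs]
      simp
    have hinv : (q : PowerSeries ℂ)⁻¹ * q = 1 :=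
      PowerSeries.inv_mul_cancel _ (by simpa [coeff_zero_eq_eval_zero] using hq0)
    rw [hgen, hcast, Polynomial.coe_mul, mul_assoc, ← mul_assoc _ (q : PowerSeries ℂ), hinv,
      one_mul]
  have hdiff : (fwdDiff N)^[q.natDegree] f = 0 := by
    ext n
    rw [← PowerSeries.coeff_mk_mul_one_sub_X_pow_pow, hmul, coeff_coe, Pi.zero_apply]
    exact coeff_eq_zero_of_degree_lt (hrs.trans_le (by exact_mod_cast Nat.le_add_left _ _))
  obtain ⟨P, hP⟩ := exists_polynomial_of_fwdDiff_iter_eq_zero _ N (q.natDegree + 1) 0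
    (fwdDiff_iter_succ_sum_range_eq_zero f N q.natDegree hdiff)
  exact ⟨P, fun m => by simpa using hP m, by simpa using hP 0⟩
end

section
/- Independence of the constant term from the chosen step: let f : ℕ → ℂ, let l₁ and l₂ be positive integers, and suppose Q₁, Q₂ ∈ ℂ[x] are polynomials such that Q₁(m) = Σ_{n=0}^{m l₁ − 1} f(n) and Q₂(m) = Σ_{n=0}^{m l₂ − 1} f(n) for every integer m ≥ 1. Then Q₁(0) = Q₂(0). -/
/-- Polynomials over a domain of characteristic zero that agree at every positive integer
are equal. -/
theorem Polynomial.eq_of_forall_one_le_eval_natCast_eq {R : Type*} [CommRing R] [IsDomain R]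
    [CharZero R] {p q : Polynomial R}
    (h : ∀ m : ℕ, 1 ≤ m → p.eval (m : R) = q.eval (m : R)) : p = q := by
  refine Polynomial.eq_of_infinite_eval_eq p q ?_
  refine ((Set.Ici_infinite 1).image Nat.cast_injective.injOn).mono ?_
  rintro _ ⟨m, hm, rfl⟩
  exact h m hm


/-- **Independence of the constant term from the chosen step**: let `f : ℕ → ℂ`,
let `l₁, l₂` be positive integers, and suppose `Q₁, Q₂ ∈ ℂ[x]` satisfy
`Q₁(m) = Σ_{n=0}^{m·l₁ - 1} f(n)` and `Q₂(m) = Σ_{n=0}^{m·l₂ - 1} f(n)` for every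
integer `m ≥ 1`.  Then `Q₁(0) = Q₂(0)`. -/
theorem constant_term_independent_of_step (f : ℕ → ℂ) (l₁ l₂ : ℕ)
    (hl₁ : 0 < l₁) (hl₂ : 0 < l₂) (Q₁ Q₂ : Polynomial ℂ)
    (hQ₁ : ∀ m : ℕ, 1 ≤ m → Q₁.eval (m : ℂ) = ∑ n ∈ Finset.range (m * l₁), f n)
    (hQ₂ : ∀ m : ℕ, 1 ≤ m → Q₂.eval (m : ℂ) = ∑ n ∈ Finset.range (m * l₂), f n) :
    Q₁.eval 0 = Q₂.eval 0 := by
  have h : Q₁.comp (Polynomial.C (l₂ : ℂ) * Polynomial.X) =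
      Q₂.comp (Polynomial.C (l₁ : ℂ) * Polynomial.X) := by
    refine Polynomial.eq_of_forall_one_le_eval_natCast_eq fun m hm => ?_
    have h₁ := hQ₁ (l₂ * m) (Nat.mul_pos hl₂ hm)
    have h₂ := hQ₂ (l₁ * m) (Nat.mul_pos hl₁ hm)
    rw [show l₁ * m * l₂ = l₂ * m * l₁ by ring, ← h₁] at h₂
    simpa using h₂.symm
  simpa using congrArg (Polynomial.eval 0) h
end
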